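/- Let R_i be a partial row over m candidates, w a candidate, and suppose there exist a candidate c ≠ w locked at position k_c (R_{i,k_c} = c) and positions k_0 < k_c < k_1 with R_{i,k_0} = null and R_{i,k_1} = null. Let R'_i be the partial row with R'_{i,k_1} = c, R'_{i,k_c} = null, and R'_{i,k} = R_{i,k} for all k ∉ {k_c, k_1}. Then Δ(R'_i) > Δ(R_i) and |R'_i| = |R_i|. -/

import Mathlib

section Defs

variable {n m : ℕ} {C : Type*}

/-- A partial row (partial ballot): each candidate appears at most once. -/
def IsPartialRow (r : Fin m → Option C) : Prop :=
  ∀ ⦃k k' : Fin m⦄ ⦃c : C⦄, r k = some c → r k' = some c → k = k'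

/-- `q` is a completion of the partial row `r` (a bijection from positions to
candidates agreeing with `r` on all non-null entries). -/
def IsCompletion (r : Fin m → Option C) (q : Fin m ≃ C) : Prop :=
  ∀ ⦃k : Fin m⦄ ⦃c : C⦄, r k = some c → q k = c

/-- Number of non-null (locked) entries of a partial row. -/
def rowSize (r : Fin m → Option C) : ℕ :=
  (Finset.univ.filter fun k : Fin m => (r k).isSome).card

/-- A partial rank matrix: each candidate appears at most once in every row. -/
def IsPartialMat (R : Fin n → Fin m → Option C) : Prop :=
  ∀ i, IsPartialRow (R i)

/-- `Q` is a complete extension of the partial rank matrix `R`: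
each row of `Q` is a bijection from positions to candidates
agreeing with the corresponding row of `R` on all non-null entries. -/
def IsMatCompletion (R : Fin n → Fin m → Option C) (Q : Fin n → Fin m ≃ C) : Prop :=
  ∀ i, IsCompletion (R i) (Q i)

/-- Number of non-null (locked) entries of a partial rank matrix. -/
def matSize (R : Fin n → Fin m → Option C) : ℕ := ∑ i, rowSize (R i)

/-- `R ⊆ R'` : the partial rank matrix `R'` extends the partial rank matrix `R`. -/
def PExt (R R' : Fin n → Fin m → Option C) : Prop :=
  ∀ i k c, R i k = some c → R' i k = some c

/-- `w` is a necessary winner of the partial rank matrix `X` under voting rule `F`. -/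
def NecessaryWinner (F : (Fin n → Fin m ≃ C) → Set C)
    (X : Fin n → Fin m → Option C) (w : C) : Prop :=
  ∀ Q : Fin n → Fin m ≃ C, IsMatCompletion X Q → w ∈ F Q

/-- `R∖Y` : the partial rank matrix obtained from the complete rank matrix `R` by
erasing (making null) the entries locked in `Y`. -/
def matDiff (R : Fin n → Fin m ≃ C) (Y : Fin n → Fin m → Option C) :
    Fin n → Fin m → Option C :=
  fun i k => if (Y i k).isSome then none else some (R i k)

/-- Borda score of candidate `c` in the complete row `q` :
a candidate in position `k+1` (index `k`) scores `m - (k+1)`. -/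
def bordaRowScore (q : Fin m ≃ C) (c : C) : ℤ := (m : ℤ) - 1 - ((q.symm c : ℕ) : ℤ)

/-- Minimal Borda score of `c` over all completions of the partial row `r`. -/
noncomputable def rowSMin (r : Fin m → Option C) (c : C) : ℤ :=
  sInf {x : ℤ | ∃ q : Fin m ≃ C, IsCompletion r q ∧ bordaRowScore q c = x}

/-- Maximal Borda score of `c` over all completions of the partial row `r`. -/
noncomputable def rowSMax (r : Fin m → Option C) (c : C) : ℤ :=
  sSup {x : ℤ | ∃ q : Fin m ≃ C, IsCompletion r q ∧ bordaRowScore q c = x}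

/-- Total score margin `Δ(r) = Σ_{c' ≠ w} (σmin_r(w) − σmax_r(c'))` of `w` in the
partial row `r`, under Borda weights. -/
noncomputable def rowDelta [Fintype C] [DecidableEq C]
    (r : Fin m → Option C) (w : C) : ℤ :=
  ∑ c ∈ Finset.univ.filter (fun c : C => c ≠ w), (rowSMin r w - rowSMax r c)

/-- Borda score of candidate `c` in the complete rank matrix `Q`. -/
def bordaScore (Q : Fin n → Fin m ≃ C) (c : C) : ℤ := ∑ i, bordaRowScore (Q i) c

/-- `w ∈ Borda(Q)` : `w` has maximal Borda score in the complete rank matrix `Q`. -/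
def IsBordaWinner (Q : Fin n → Fin m ≃ C) (w : C) : Prop :=
  ∀ c, bordaScore Q c ≤ bordaScore Q w

/-- Score of candidate `c` in the complete rank matrix `Q` under the scoring rule
with weight vector `wt`. -/
def scoreW (wt : Fin m → ℝ) (Q : Fin n → Fin m ≃ C) (c : C) : ℝ :=
  ∑ i, wt ((Q i).symm c)

/-- `σmin_R(c)` : minimal score of `c` over all complete extensions of `R`. -/
noncomputable def matSMinW (wt : Fin m → ℝ) (R : Fin n → Fin m → Option C) (c : C) : ℝ :=
  sInf {x : ℝ | ∃ Q : Fin n → Fin m ≃ C, IsMatCompletion R Q ∧ scoreW wt Q c = x}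

/-- `σmax_R(c)` : maximal score of `c` over all complete extensions of `R`. -/
noncomputable def matSMaxW (wt : Fin m → ℝ) (R : Fin n → Fin m → Option C) (c : C) : ℝ :=
  sSup {x : ℝ | ∃ Q : Fin n → Fin m ≃ C, IsMatCompletion R Q ∧ scoreW wt Q c = x}

/-- `σmin_{R_i}(c)` : minimal score of `c` over all completions of the single row `r`. -/
noncomputable def rowSMinW (wt : Fin m → ℝ) (r : Fin m → Option C) (c : C) : ℝ :=
  sInf {x : ℝ | ∃ q : Fin m ≃ C, IsCompletion r q ∧ wt (q.symm c) = x}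

/-- `σmax_{R_i}(c)` : maximal score of `c` over all completions of the single row `r`. -/
noncomputable def rowSMaxW (wt : Fin m → ℝ) (r : Fin m → Option C) (c : C) : ℝ :=
  sSup {x : ℝ | ∃ q : Fin m ≃ C, IsCompletion r q ∧ wt (q.symm c) = x}

/-- `r` is in normal form of parameters `k1, k2`: a position `p = k+1` is null
exactly when `k1 < p < m + 1 - k2`. -/
def IsNormalForm (r : Fin m → Option C) (k1 k2 : ℕ) : Prop :=
  ∀ k : Fin m, r k = none ↔ (k1 < (k : ℕ) + 1 ∧ (k : ℕ) + 1 < m + 1 - k2)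

end Defs

section RowLemmas

variable {m : ℕ} {C : Type*}

theorem rowSize_comp_perm (r : Fin m → Option C) (e : Equiv.Perm (Fin m)) :
    rowSize (r ∘ e) = rowSize r :=
  Finset.card_equiv e (by simp)

theorem IsCompletion.comp_perm {r : Fin m → Option C} {q : Fin m ≃ C} (h : IsCompletion r q)
    (e : Equiv.Perm (Fin m)) : IsCompletion (r ∘ e) (e.trans q) :=
  fun _ _ hk => h hk

theorem IsCompletion.of_comp_perm {r : Fin m → Option C} {e : Equiv.Perm (Fin m)}
    {q : Fin m ≃ C} (h : IsCompletion (r ∘ e) q) : IsCompletion r (e.symm.trans q) :=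
  fun k _ hk => h (k := e.symm k) (by simpa using hk)

/-- Exchanging the candidates at two null positions preserves completions. -/
theorem IsCompletion.swap_trans {r : Fin m → Option C} {q : Fin m ≃ C} (h : IsCompletion r q)
    {a b : Fin m} (ha : r a = none) (hb : r b = none) :
    IsCompletion r ((Equiv.swap a b).trans q) := by
  intro k c hk
  have hka : k ≠ a := by rintro rfl; simp [ha] at hk
  have hkb : k ≠ b := by rintro rfl; simp [hb] at hk
  simpa [Equiv.swap_apply_of_ne_of_ne hka hkb] using h hk

theorem IsCompletion.symm_apply {r : Fin m → Option C} {q : Fin m ≃ C} (h : IsCompletion r q)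
    {k : Fin m} {c : C} (hk : r k = some c) : q.symm c = k := by
  rw [Equiv.symm_apply_eq, h hk]

theorem IsPartialRow.exists_isCompletion [Fintype C] (hC : Fintype.card C = m)
    {r : Fin m → Option C} (hr : IsPartialRow r) (w : C) : ∃ q, IsCompletion r q := by
  classical
  obtain ⟨g, hg⟩ := Finset.exists_equiv_extend_of_card_eq (α := Fin m)
    (t := (Finset.univ : Finset C))
    (by simp [hC]) (s := Finset.univ.filter fun k => (r k).isSome)
    (f := fun k => (r k).getD w) (Finset.subset_univ _) (by
      intro a ha b hb hab
      simp only [Finset.coe_filter, Finset.mem_univ, true_and, Set.mem_ofPred_eq,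
        Option.isSome_iff_exists] at ha hb
      obtain ⟨x, hx⟩ := ha
      obtain ⟨y, hy⟩ := hb
      simp only [hx, hy, Option.getD_some] at hab
      exact hr hx (hab ▸ hy))
  refine ⟨g.trans (Equiv.subtypeUnivEquiv Finset.mem_univ), fun k c hk => ?_⟩
  have := hg k (by simp [hk])
  simpa [hk] using this

theorem bddBelow_bordaRowScore (r : Fin m → Option C) (c : C) :
    BddBelow {x : ℤ | ∃ q : Fin m ≃ C, IsCompletion r q ∧ bordaRowScore q c = x} := by
  refine ⟨0, ?_⟩
  rintro _ ⟨q, -, rfl⟩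
  have := (q.symm c).isLt
  simp only [bordaRowScore]
  omega

theorem bddAbove_bordaRowScore (r : Fin m → Option C) (c : C) :
    BddAbove {x : ℤ | ∃ q : Fin m ≃ C, IsCompletion r q ∧ bordaRowScore q c = x} := by
  refine ⟨m, ?_⟩
  rintro _ ⟨q, -, rfl⟩
  simp only [bordaRowScore]
  omega

theorem rowSMin_mono {r r' : Fin m → Option C} {c : C} (hne : ∃ q, IsCompletion r' q)
    (h : ∀ q', IsCompletion r' q' → ∃ q, IsCompletion r q ∧ q'.symm c ≤ q.symm c) :
    rowSMin r c ≤ rowSMin r' c := by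
  obtain ⟨q₀, hq₀⟩ := hne
  refine le_csInf ⟨_, q₀, hq₀, rfl⟩ ?_
  rintro _ ⟨q', hq', rfl⟩
  obtain ⟨q, hq, hle⟩ := h q' hq'
  refine (csInf_le (bddBelow_bordaRowScore r c) ⟨q, hq, rfl⟩).trans ?_
  simp only [bordaRowScore]
  omega

theorem rowSMax_mono {r r' : Fin m → Option C} {c : C} (hne : ∃ q, IsCompletion r' q)
    (h : ∀ q', IsCompletion r' q' → ∃ q, IsCompletion r q ∧ q.symm c ≤ q'.symm c) :
    rowSMax r' c ≤ rowSMax r c := by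
  obtain ⟨q₀, hq₀⟩ := hne
  refine csSup_le ⟨_, q₀, hq₀, rfl⟩ ?_
  rintro _ ⟨q', hq', rfl⟩
  obtain ⟨q, hq, hle⟩ := h q' hq'
  refine le_trans ?_ (le_csSup (bddAbove_bordaRowScore r c) ⟨q, hq, rfl⟩)
  simp only [bordaRowScore]
  omega

theorem rowSMax_of_locked {r : Fin m → Option C} {c : C} {k : Fin m} (hk : r k = some c)
    (hne : ∃ q, IsCompletion r q) : rowSMax r c = (m : ℤ) - 1 - (k : ℕ) := by
  obtain ⟨q₀, hq₀⟩ := hne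
  have : {x : ℤ | ∃ q : Fin m ≃ C, IsCompletion r q ∧ bordaRowScore q c = x} =
      {(m : ℤ) - 1 - (k : ℕ)} := by
    ext x
    constructor
    · rintro ⟨q, hq, rfl⟩
      simp [bordaRowScore, hq.symm_apply hk]
    · rintro rfl
      exact ⟨q₀, hq₀, by simp [bordaRowScore, hq₀.symm_apply hk]⟩
  rw [rowSMax, this, csSup_singleton]

theorem rowSMin_le_rowSMin_comp_swap {r : Fin m → Option C} {c w : C} (hc : c ≠ w)
    {kc k1 : Fin m} (hkc : r kc = some c) (hlt : kc < k1)
    (hne : ∃ q, IsCompletion (r ∘ Equiv.swap kc k1) q) :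
    rowSMin r w ≤ rowSMin (r ∘ Equiv.swap kc k1) w := by
  refine rowSMin_mono hne fun q' hq' => ⟨_, hq'.of_comp_perm, ?_⟩
  have hw : q'.symm w ≠ k1 := by
    rw [← hq'.symm_apply (c := c) (k := k1) (by simpa using hkc)]
    exact fun h => hc (q'.symm.injective h).symm
  by_cases hwc : q'.symm w = kc
  · simpa [hwc] using hlt.le
  · simp [Equiv.swap_apply_of_ne_of_ne hwc hw]

theorem rowSMax_comp_swap_le {r : Fin m → Option C} {c d : C} (hc : c ≠ d)
    {k0 kc k1 : Fin m} (hkc : r kc = some c) (hk0 : r k0 = none) (hk1 : r k1 = none)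
    (h0c : k0 < kc) (hne : ∃ q, IsCompletion (r ∘ Equiv.swap kc k1) q) :
    rowSMax (r ∘ Equiv.swap kc k1) d ≤ rowSMax r d := by
  refine rowSMax_mono hne fun q' hq' => ?_
  have hd : q'.symm d ≠ k1 := by
    rw [← hq'.symm_apply (c := c) (k := k1) (by simpa using hkc)]
    exact fun h => hc (q'.symm.injective h).symm
  by_cases hdc : q'.symm d = kc
  · refine ⟨_, hq'.of_comp_perm.swap_trans hk0 hk1, ?_⟩
    simpa [hdc] using h0c.le
  · refine ⟨_, hq'.of_comp_perm, ?_⟩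
    simp [Equiv.swap_apply_of_ne_of_ne hdc hd]

end RowLemmas

/- STATEMENT 10 -/
theorem stmt10 {m : ℕ} {C : Type*} [Fintype C] [DecidableEq C]
    (hm : 2 ≤ m) (hC : Fintype.card C = m)
    (r : Fin m → Option C) (hr : IsPartialRow r) (w : C)
    (c : C) (hc : c ≠ w) (kc : Fin m) (hkc : r kc = some c)
    (k0 k1 : Fin m) (hk0 : r k0 = none) (hk1 : r k1 = none)
    (horder : k0 < kc ∧ kc < k1) :
    rowDelta (fun k : Fin m => if k = k1 then some c
        else if k = kc then none else r k) w > rowDelta r w ∧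
    rowSize (fun k : Fin m => if k = k1 then some c
        else if k = kc then none else r k) = rowSize r := by
  have hrow : (fun k : Fin m => if k = k1 then some c else if k = kc then none else r k) =
      r ∘ Equiv.swap kc k1 := by
    funext k
    have hne : kc ≠ k1 := horder.2.ne
    by_cases h1 : k = k1
    · simp [h1, hkc]
    · by_cases h2 : k = kc
      · simp [h2, hne, hk1]
      · simp [h1, h2, Equiv.swap_apply_of_ne_of_ne h2 h1]
  rw [hrow]
  refine ⟨?_, rowSize_comp_perm r _⟩
  obtain ⟨q, hq⟩ := hr.exists_isCompletion hC w
  have hne : ∃ q, IsCompletion (r ∘ Equiv.swap kc k1) q := ⟨_, hq.comp_perm _⟩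
  have hmin := rowSMin_le_rowSMin_comp_swap hc hkc horder.2 hne
  have hlt : rowSMax (r ∘ Equiv.swap kc k1) c < rowSMax r c := by
    rw [rowSMax_of_locked hkc ⟨q, hq⟩, rowSMax_of_locked (k := k1) (by simpa using hkc) hne]
    have := horder.2
    omega
  refine Finset.sum_lt_sum (fun d _ => sub_le_sub hmin ?_)
    ⟨c, by simp [hc], by omega⟩
  rcases eq_or_ne c d with rfl | hcd
  · exact hlt.le
  · exact rowSMax_comp_swap_le hcd hkc hk0 hk1 horder.1 hne
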